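/- Let G = ([n], E) be a natural unit interval graph and let σ be a permutation of [n] with one-line notation σ_1σ_2…σ_n such that every descent of σ is a G-descent. Let C = {x ∈ ℝ^n : x_a ≥ x_b for every edge {a,b} ∈ E such that a precedes b in the one-line notation of σ}. Let v = (v_1, …, v_n) ∈ ℝ^n satisfy v_i > (6n² + 1)v_{i+1} for all 1 ≤ i < n and v_n > 0, and let p be the unique point of C minimizing the Euclidean distance to v. Then the number of connected components of the graph on vertex set [n] with edge set {{i,j} ∈ E : p_i = p_j} equals RLmin(σ), the number of right-to-left minima of σ. -/

import Mathlib

open Classical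

/-- `G` is a natural unit interval graph: for every edge `{i,j}` with `i < j` and every
`i < k < j`, both `{i,k}` and `{k,j}` are edges. -/
def IsNaturalUnitIntervalGraph {n : ℕ} (G : SimpleGraph (Fin n)) : Prop :=
  ∀ i j k : Fin n, G.Adj i j → i < k → k < j → G.Adj i k ∧ G.Adj k j

/-- Every descent of `σ` is a `G`-descent: whenever `σ_t > σ_{t+1}`,
`{σ_t, σ_{t+1}}` is an edge of `G`. -/
def AllDescentsGDescents {n : ℕ} (G : SimpleGraph (Fin n)) (σ : Equiv.Perm (Fin n)) : Prop :=
  ∀ (t : ℕ) (h : t + 1 < n), σ ⟨t + 1, h⟩ < σ ⟨t, Nat.lt_of_succ_lt h⟩ →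
    G.Adj (σ ⟨t, Nat.lt_of_succ_lt h⟩) (σ ⟨t + 1, h⟩)

/-- The smallest entry of `σ` at or after the position of the entry `a`. -/
noncomputable def suffixMin {n : ℕ} (σ : Equiv.Perm (Fin n)) (a : Fin n) : Fin n :=
  (Finset.univ.filter fun b => σ.symm a ≤ σ.symm b).min' ⟨a, by simp⟩

section SuffixMin

variable {n : ℕ} (σ : Equiv.Perm (Fin n))

lemma symm_le_symm_suffixMin (a : Fin n) : σ.symm a ≤ σ.symm (suffixMin σ a) := by
  have h := Finset.min'_mem (Finset.univ.filter fun b => σ.symm a ≤ σ.symm b) ⟨a, by simp⟩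
  exact (Finset.mem_filter.mp h).2

variable {σ}

lemma suffixMin_le_of_symm_le {a b : Fin n} (h : σ.symm a ≤ σ.symm b) : suffixMin σ a ≤ b :=
  Finset.min'_le _ _ (by simpa using h)

lemma suffixMin_le (a : Fin n) : suffixMin σ a ≤ a := suffixMin_le_of_symm_le le_rfl

lemma suffixMin_mono {a b : Fin n} (h : σ.symm a ≤ σ.symm b) : suffixMin σ a ≤ suffixMin σ b :=
  suffixMin_le_of_symm_le (h.trans (symm_le_symm_suffixMin σ b))

lemma suffixMin_suffixMin (a : Fin n) : suffixMin σ (suffixMin σ a) = suffixMin σ a :=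
  (suffixMin_le _).antisymm (suffixMin_mono (symm_le_symm_suffixMin σ a))

lemma suffixMin_apply_eq_iff (i : Fin n) :
    suffixMin σ (σ i) = σ i ↔ ∀ j, i < j → σ i < σ j := by
  constructor
  · intro h j hij
    have h1 : suffixMin σ (σ i) ≤ σ j := suffixMin_le_of_symm_le (by simpa using hij.le)
    rw [h] at h1
    exact h1.lt_of_ne fun h2 => hij.ne (σ.injective h2)
  · intro h
    refine (suffixMin_le _).antisymm ?_
    have h1 := symm_le_symm_suffixMin σ (σ i)
    rw [Equiv.symm_apply_apply] at h1
    rcases h1.eq_or_lt with h2 | h2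
    · exact (σ.eq_symm_apply.mp h2).le
    · simpa using (h _ h2).le

/-- An entry that is not a right-to-left minimum is adjacent to the first smaller entry
after it, which has the same suffix minimum. -/
lemma exists_adj_suffixMin_eq {G : SimpleGraph (Fin n)} (hG : IsNaturalUnitIntervalGraph G)
    (hσ : AllDescentsGDescents G σ) {a : Fin n} (ha : suffixMin σ a ≠ a) :
    ∃ b, G.Adj a b ∧ σ.symm a < σ.symm b ∧ b < a ∧ suffixMin σ b = suffixMin σ a := by
  have hlt : suffixMin σ a < a := (suffixMin_le a).lt_of_ne ha
  have hex : ∃ t : ℕ, ∃ h : t < n, σ.symm a ≤ ⟨t, h⟩ ∧ σ ⟨t, h⟩ < a :=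
    ⟨_, (σ.symm (suffixMin σ a)).2, symm_le_symm_suffixMin σ a, by simpa using hlt⟩
  obtain ⟨ht, hat, hta⟩ := Nat.find_spec hex
  have hmin := fun m => Nat.find_min (H := hex) (m := m)
  set t := Nat.find hex
  have hat' : σ.symm a < ⟨t, ht⟩ := by
    refine hat.lt_of_ne fun h => hta.ne ?_
    rw [← h, Equiv.apply_symm_apply]
  have hpos : (σ.symm a : ℕ) < t := hat'
  obtain ⟨s, hs⟩ : ∃ s, t = s + 1 := ⟨t - 1, by omega⟩
  have hsn : s < n := by omega
  have hsa : a ≤ σ ⟨s, hsn⟩ := by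
    by_contra! h
    exact hmin s (by omega) ⟨hsn, Fin.le_def.mpr (by simp; omega), h⟩
  have hadj : G.Adj (σ ⟨s, hsn⟩) (σ ⟨t, ht⟩) := by
    have h := hσ s (hs ▸ ht)
    simp only [← hs] at h
    exact h (hta.trans_le hsa)
  refine ⟨σ ⟨t, ht⟩, ?_, by simpa using hat', hta, ?_⟩
  · rcases hsa.eq_or_lt with h | h
    · rwa [← h] at hadj
    · exact (hG _ _ a hadj.symm hta h).1.symm
  · refine le_antisymm (suffixMin_le_of_symm_le ?_) (suffixMin_mono (by simpa using hat))
    rw [Equiv.symm_apply_apply]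
    by_contra! h
    exact hmin _ h ⟨(σ.symm (suffixMin σ a)).2, symm_le_symm_suffixMin σ a, by simpa using hlt⟩

lemma apply_suffixMin_le {G : SimpleGraph (Fin n)} (hG : IsNaturalUnitIntervalGraph G)
    (hσ : AllDescentsGDescents G σ) {x : Fin n → ℝ}
    (hx : ∀ a b, G.Adj a b → σ.symm a < σ.symm b → x b ≤ x a) (a : Fin n) :
    x (suffixMin σ a) ≤ x a := by
  induction a using WellFoundedLT.induction with
  | ind a ih =>
    by_cases ha : suffixMin σ a = a
    · rw [ha]
    · obtain ⟨b, hab, hpos, hlt, hb⟩ := exists_adj_suffixMin_eq hG hσ ha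
      exact hb ▸ (ih b hlt).trans (hx a b hab hpos)

lemma reachable_suffixMin {G H : SimpleGraph (Fin n)} (hG : IsNaturalUnitIntervalGraph G)
    (hσ : AllDescentsGDescents G σ)
    (hH : ∀ a b, G.Adj a b → suffixMin σ a = suffixMin σ b → H.Adj a b) (a : Fin n) :
    H.Reachable a (suffixMin σ a) := by
  induction a using WellFoundedLT.induction with
  | ind a ih =>
    by_cases ha : suffixMin σ a = a
    · rw [ha]
    · obtain ⟨b, hab, -, hlt, hb⟩ := exists_adj_suffixMin_eq hG hσ ha
      exact hb ▸ (hH a b hab hb.symm).reachable.trans (ih b hlt)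

/-- If the components of `H` are the fibres of `suffixMin σ`, then they are counted by the
right-to-left minima of `σ`. -/
lemma card_connectedComponent_eq_card_rlmin {H : SimpleGraph (Fin n)}
    (hadj : ∀ a b, H.Adj a b → suffixMin σ a = suffixMin σ b)
    (hreach : ∀ a, H.Reachable a (suffixMin σ a)) :
    Nat.card H.ConnectedComponent
      = (Finset.univ.filter fun i : Fin n => ∀ j : Fin n, i < j → σ i < σ j).card := by
  have hconst : ∀ a b, H.Reachable a b → suffixMin σ a = suffixMin σ b := by
    rintro a b ⟨w⟩
    induction w with
    | nil => rfl
    | cons h _ ih => exact (hadj _ _ h).trans ih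
  rw [← Fintype.card_coe, ← Nat.card_eq_fintype_card]
  refine (Nat.card_congr (Equiv.ofBijective
    (fun i : (Finset.univ.filter fun i : Fin n => ∀ j : Fin n, i < j → σ i < σ j) =>
      H.connectedComponentMk (σ i)) ⟨?_, ?_⟩)).symm
  · rintro ⟨i, hi⟩ ⟨j, hj⟩ hij
    have h := hconst _ _ (SimpleGraph.ConnectedComponent.eq.mp hij)
    rw [(suffixMin_apply_eq_iff i).mpr (by simpa using hi),
      (suffixMin_apply_eq_iff j).mpr (by simpa using hj)] at h
    exact Subtype.ext (σ.injective h)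
  · intro c
    induction c using SimpleGraph.ConnectedComponent.ind with
    | h a =>
      refine ⟨⟨σ.symm (suffixMin σ a), ?_⟩, ?_⟩
      · rw [Finset.mem_filter]
        refine ⟨Finset.mem_univ _, (suffixMin_apply_eq_iff _).mp ?_⟩
        rw [Equiv.apply_symm_apply, suffixMin_suffixMin]
      · simpa using (hreach a).symm

end SuffixMin

/-- The average of `v` over the fibre of `f` above `m`. -/
noncomputable def fiberAverage {ι κ : Type*} [Fintype ι] [DecidableEq κ] (f : ι → κ) (v : ι → ℝ)
    (m : κ) : ℝ :=
  (∑ b with f b = m, v b) / (Finset.univ.filter fun b => f b = m).card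

lemma sum_sub_fiberAverage_mul {ι κ : Type*} [Fintype ι] [Fintype κ] [DecidableEq κ]
    (f : ι → κ) (v : ι → ℝ) (g : κ → ℝ) :
    ∑ a, (v a - fiberAverage f v (f a)) * g (f a) = 0 := by
  rw [← Finset.sum_fiberwise Finset.univ f]
  refine Finset.sum_eq_zero fun m _ => ?_
  have h : ∑ a with f a = m, (v a - fiberAverage f v (f a)) * g (f a)
      = ∑ a with f a = m, (v a - fiberAverage f v m) * g m :=
    Finset.sum_congr rfl fun a ha => by rw [(Finset.mem_filter.mp ha).2]
  rw [h, ← Finset.sum_mul, Finset.sum_sub_distrib, Finset.sum_const, nsmul_eq_mul, fiberAverage]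
  rcases (Finset.univ.filter fun b => f b = m).eq_empty_or_nonempty with he | hne
  · simp [he]
  · have : ((Finset.univ.filter fun b => f b = m).card : ℝ) ≠ 0 := by
      exact_mod_cast hne.card_pos.ne'
    field_simp
    ring

lemma fiberAverage_le {ι κ : Type*} [Fintype ι] [DecidableEq κ] {f : ι → κ} {v : ι → ℝ}
    {a : ι} {c : ℝ} (h : ∀ b, f b = f a → v b ≤ c) : fiberAverage f v (f a) ≤ c := by
  have hpos : 0 < (Finset.univ.filter fun b => f b = f a).card :=
    Finset.card_pos.mpr ⟨a, by simp⟩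
  rw [fiberAverage, div_le_iff₀ (by exact_mod_cast hpos), mul_comm, ← nsmul_eq_mul]
  exact Finset.sum_le_card_nsmul _ _ _ fun b hb => h b (Finset.mem_filter.mp hb).2

lemma div_card_le_fiberAverage {ι κ : Type*} [Fintype ι] [DecidableEq κ] {f : ι → κ} {v : ι → ℝ}
    (hv : ∀ i, 0 ≤ v i) (a : ι) : v a / Fintype.card ι ≤ fiberAverage f v (f a) := by
  have hpos : 0 < (Finset.univ.filter fun b => f b = f a).card :=
    Finset.card_pos.mpr ⟨a, by simp⟩
  refine div_le_div₀ (Finset.sum_nonneg fun b _ => hv b) ?_ (by exact_mod_cast hpos)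
    (by exact_mod_cast Finset.card_le_univ _)
  exact Finset.single_le_sum (f := v) (fun b _ => hv b) (by simp)

lemma pos_of_rapidly_decreasing {n : ℕ} {v : Fin n → ℝ}
    (hv : ∀ i j : Fin n, (i : ℕ) + 1 = j → (6 * (n : ℝ) ^ 2 + 1) * v j < v i)
    (hlast : ∀ i : Fin n, (i : ℕ) + 1 = n → 0 < v i) (i : Fin n) : 0 < v i := by
  induction i using WellFoundedGT.induction with
  | ind i ih =>
    by_cases h : (i : ℕ) + 1 = n
    · exact hlast i h
    · obtain ⟨j, hj⟩ : ∃ j : Fin n, (i : ℕ) + 1 = j := ⟨⟨i + 1, by omega⟩, rfl⟩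
      have hj0 : 0 < v j := ih j (Fin.lt_def.mpr (by omega))
      exact lt_trans (by positivity) (hv i j hj)

lemma mul_lt_of_rapidly_decreasing {n : ℕ} {v : Fin n → ℝ}
    (hv : ∀ i j : Fin n, (i : ℕ) + 1 = j → (6 * (n : ℝ) ^ 2 + 1) * v j < v i)
    (hpos : ∀ i, 0 < v i) {i j : Fin n} (hij : i < j) : n * v j < v i := by
  have step : ∀ i j : Fin n, (i : ℕ) + 1 = j → n * v j < v i := by
    intro i j h
    refine lt_of_le_of_lt (mul_le_mul_of_nonneg_right ?_ (hpos _).le) (hv i j h)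
    nlinarith [sq_nonneg ((n : ℝ) - 1)]
  have anti : StrictAnti v := by
    cases n with
    | zero => exact fun i => i.elim0
    | succ m =>
      refine Fin.strictAnti_iff_succ_lt.mpr fun k => ?_
      refine lt_of_le_of_lt ?_ (step k.castSucc k.succ (by simp))
      exact le_mul_of_one_le_left (hpos _).le (by simp)
  obtain ⟨k, hk⟩ : ∃ k : Fin n, (i : ℕ) + 1 = k := ⟨⟨i + 1, by omega⟩, rfl⟩
  refine lt_of_le_of_lt ?_ (step i k hk)
  exact mul_le_mul_of_nonneg_left (anti.antitone (Fin.le_def.mpr (by omega))) (Nat.cast_nonneg n)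

lemma eq_of_dist_le_of_inner_nonpos {E : Type*} [NormedAddCommGroup E] [InnerProductSpace ℝ E]
    {v p q : E} (hdist : dist v p ≤ dist v q) (hinner : inner ℝ (v - q) (p - q) ≤ 0) :
    p = q := by
  rw [dist_eq_norm, dist_eq_norm] at hdist
  have h := norm_sub_sq_real (v - q) (p - q)
  rw [sub_sub_sub_cancel_right] at h
  have h' : ‖v - p‖ ^ 2 ≤ ‖v - q‖ ^ 2 := by gcongr
  have h0 : ‖p - q‖ = 0 := by nlinarith [norm_nonneg (p - q)]
  exact sub_eq_zero.mp (norm_eq_zero.mp h0)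

/-- in the setting of Statement 14, the number of connected components of
the graph on `[n]` with edges `{{i,j} ∈ E : p_i = p_j}` equals the number of
right-to-left minima of `σ`. -/
theorem graphical_projection_dimension_RLmin {n : ℕ} (hn : 1 ≤ n)
    (G : SimpleGraph (Fin n)) (hG : IsNaturalUnitIntervalGraph G)
    (σ : Equiv.Perm (Fin n)) (hσ : AllDescentsGDescents G σ)
    (v : EuclideanSpace ℝ (Fin n))
    (hv : ∀ i : ℕ, ∀ h : i + 1 < n, (6 * (n : ℝ) ^ 2 + 1) * v ⟨i + 1, h⟩ < v ⟨i, by omega⟩)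
    (hvn : 0 < v ⟨n - 1, by omega⟩)
    (p : EuclideanSpace ℝ (Fin n))
    (hp : ∀ a b : Fin n, G.Adj a b → σ.symm a < σ.symm b → p b ≤ p a)
    (hmin : ∀ x : EuclideanSpace ℝ (Fin n),
      (∀ a b : Fin n, G.Adj a b → σ.symm a < σ.symm b → x b ≤ x a) →
      dist v p ≤ dist v x) :
    Nat.card (SimpleGraph.fromRel fun i j : Fin n => G.Adj i j ∧ p i = p j).ConnectedComponent
      = (Finset.univ.filter fun i : Fin n => ∀ j : Fin n, i < j → σ i < σ j).card := by
  have hsucc : ∀ i j : Fin n, (i : ℕ) + 1 = j → (6 * (n : ℝ) ^ 2 + 1) * v j < v i := by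
    rintro i ⟨j, hj⟩ rfl
    exact hv i hj
  have hlast : ∀ i : Fin n, (i : ℕ) + 1 = n → 0 < v i := by
    intro i hi
    rwa [show i = ⟨n - 1, by omega⟩ from Fin.ext (by simp; omega)]
  have hpos := pos_of_rapidly_decreasing hsucc hlast
  have hdom : ∀ {i j : Fin n}, i < j → n * v j < v i := mul_lt_of_rapidly_decreasing hsucc hpos
  have hnpos : (0 : ℝ) < n := by exact_mod_cast hn
  have hle : ∀ {i j : Fin n}, i ≤ j → v j ≤ v i := by
    intro i j hij
    rcases hij.eq_or_lt with rfl | h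
    · rfl
    · exact (le_mul_of_one_le_left (hpos j).le (by exact_mod_cast hn)).trans (hdom h).le
  set q : Fin n → ℝ := fun a => fiberAverage (suffixMin σ) v (suffixMin σ a) with hq
  have hlow : ∀ a, v (suffixMin σ a) / n ≤ q a := by
    intro a
    have h := div_card_le_fiberAverage (f := suffixMin σ) (fun i => (hpos i).le) (suffixMin σ a)
    rwa [suffixMin_suffixMin, Fintype.card_fin] at h
  have hlt_low : ∀ {a b}, suffixMin σ a < b → v b < q a := fun {a b} h =>
    lt_of_lt_of_le ((lt_div_iff₀' hnpos).mpr (hdom h)) (hlow a)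
  have hup : ∀ a, q a ≤ v (suffixMin σ a) := fun a =>
    fiberAverage_le fun b hb => hle (hb ▸ suffixMin_le b)
  have hstrict : ∀ {a b}, suffixMin σ a < suffixMin σ b → q b < q a := fun {a b} h =>
    (hup b).trans_lt (hlt_low h)
  have hinner : ∑ a, (v a - q a) * (p a - q a) ≤ 0 := by
    have h := sum_sub_fiberAverage_mul (suffixMin σ) v
      fun m => p m - fiberAverage (suffixMin σ) v m
    rw [← h]
    refine Finset.sum_le_sum fun a _ => ?_
    have hpa : p (suffixMin σ a) ≤ p a := apply_suffixMin_le hG hσ hp a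
    change (v a - q a) * (p a - q a) ≤ (v a - q a) * (p (suffixMin σ a) - q a)
    by_cases ha : suffixMin σ a = a
    · rw [ha]
    · have hva := hlt_low ((suffixMin_le a).lt_of_ne ha)
      nlinarith
  have hpq : p = WithLp.toLp 2 q := by
    refine eq_of_dist_le_of_inner_nonpos (hmin _ fun a b _ hab => ?_) ?_
    · rcases (suffixMin_mono hab.le).eq_or_lt with h | h
      · simp [hq, h]
      · exact (hstrict h).le
    · simpa [PiLp.inner_apply, mul_comm] using hinner
  have hiff : ∀ a b, p a = p b ↔ suffixMin σ a = suffixMin σ b := by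
    intro a b
    rw [hpq]
    refine ⟨fun h => ?_, fun h => by simp [hq, h]⟩
    rcases lt_trichotomy (suffixMin σ a) (suffixMin σ b) with h' | h' | h'
    · exact absurd h (hstrict h').ne'
    · exact h'
    · exact absurd h (hstrict h').ne
  refine card_connectedComponent_eq_card_rlmin (fun a b h => ?_) fun a =>
    reachable_suffixMin hG hσ (fun a b hab h => ?_) a
  · rw [SimpleGraph.fromRel_adj] at h
    rcases h.2 with h | h
    · exact (hiff a b).mp h.2
    · exact ((hiff b a).mp h.2).symm
  · rw [SimpleGraph.fromRel_adj]
    exact ⟨hab.ne, Or.inl ⟨hab, (hiff a b).mpr h⟩⟩
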